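/- For every odd prime power q, the operator μ ↦ μP_Her on ℓ²(π_Her) is Hilbert–Schmidt (in particular compact) and self-adjoint, and its set of eigenvalues is exactly {(−q)^{−k} : k ≥ 0} = {q^{−k} : k ≥ 0 even} ∪ {−q^{−k} : k ≥ 1 odd}. -/

import Mathlib

noncomputable section

open scoped ENNReal

/-- The transition matrix `P_Her` (Hermitian matrices). -/
def PHer (q : ℝ) (i j : ℕ) : ℝ :=
  if j = i + 1 then q⁻¹ ^ (2 * i + 1)
  else if j = i then q⁻¹ ^ (2 * i) * (1 - q⁻¹)
  else if i = j + 1 then 1 - q⁻¹ ^ (2 * i)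
  else 0

/-- `β(q) = ∏_{i ≥ 1, i odd} (1 + q^{-i})^{-1}`. -/
def betaQ (q : ℝ) : ℝ := ∏' i : ℕ, (1 + q⁻¹ ^ (2 * i + 1))⁻¹

/-- `π_Her(j) = β(q)/(q^{j²}·η_j(q²))`, where `η_j(q²) = ∏_{i=1}^{j}(1 − q^{-2i})`. -/
def piHer (q : ℝ) (j : ℕ) : ℝ :=
  betaQ q / (q ^ (j ^ 2) * ∏ i ∈ Finset.range j, (1 - q⁻¹ ^ (2 * (i + 1))))

section Spectrum

open InnerProductSpace Filter Topology

local notation "ℓ²" => lp (fun _ : ℕ => ℂ) 2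

/-- The standard basis vector of `ℓ²(ℕ, ℂ)`. -/
def stdVec (k : ℕ) : ℓ² := lp.single 2 k 1

lemma stdVec_apply (k j : ℕ) : stdVec k j = if j = k then 1 else 0 := by
  simp [stdVec, Pi.single_apply]

lemma norm_stdVec (k : ℕ) : ‖stdVec k‖ = 1 := by
  simp [stdVec, lp.norm_single]

lemma inner_stdVec_left (k : ℕ) (f : ℓ²) : inner ℂ (stdVec k) f = f k := by
  simp [stdVec, lp.inner_single_left]

lemma norm_sq_eq_tsum (f : ℓ²) : ‖f‖ ^ 2 = ∑' i, ‖f i‖ ^ 2 := by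
  have h := lp.norm_rpow_eq_tsum (p := 2) (by norm_num) f
  simpa using h

/-- The `k`-th self-adjoint block of the Jacobi operator with diagonal `d` and off-diagonal `a`. -/
def jacobiBlock (d a : ℕ → ℝ) (k : ℕ) : ℓ² →L[ℂ] ℓ² :=
  (d k : ℂ) • rankOne ℂ (stdVec k) (stdVec k) +
    (a k : ℂ) • (rankOne ℂ (stdVec k) (stdVec (k + 1)) + rankOne ℂ (stdVec (k + 1)) (stdVec k))

/-- The Jacobi operator on `ℓ²(ℕ, ℂ)` with diagonal `d` and off-diagonal `a`. -/
def jacobi (d a : ℕ → ℝ) : ℓ² →L[ℂ] ℓ² := ∑' k, jacobiBlock d a k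

lemma isSelfAdjoint_jacobiBlock (d a : ℕ → ℝ) (k : ℕ) : IsSelfAdjoint (jacobiBlock d a k) := by
  rw [ContinuousLinearMap.isSelfAdjoint_iff', jacobiBlock, map_add, map_smulₛₗ, map_smulₛₗ, map_add,
    adjoint_rankOne, adjoint_rankOne, adjoint_rankOne, Complex.conj_ofReal, Complex.conj_ofReal,
    add_comm (rankOne ℂ (stdVec (k + 1)) (stdVec k))]

lemma isCompactOperator_rankOne (u v : ℓ²) : IsCompactOperator (rankOne ℂ u v) := by
  rw [rankOne_def']
  exact (isCompactOperator_of_locallyCompactSpace_rng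
    (ContinuousLinearMap.toSpanSingleton ℂ u)).comp_clm _

lemma isCompactOperator_jacobiBlock (d a : ℕ → ℝ) (k : ℕ) :
    IsCompactOperator (jacobiBlock d a k) :=
  ((isCompactOperator_rankOne _ _).smul _).add
    (((isCompactOperator_rankOne _ _).add (isCompactOperator_rankOne _ _)).smul _)

lemma norm_jacobiBlock_le (d a : ℕ → ℝ) (k : ℕ) :
    ‖jacobiBlock d a k‖ ≤ |d k| + |a k| * 2 := by
  refine (norm_add_le _ _).trans (add_le_add ?_ ?_)
  · rw [norm_smul, Complex.norm_real, Real.norm_eq_abs, norm_rankOne]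
    simp [norm_stdVec]
  · rw [norm_smul, Complex.norm_real, Real.norm_eq_abs]
    gcongr
    refine (norm_add_le _ _).trans ?_
    simp [norm_stdVec]
    norm_num

lemma jacobiBlock_apply (d a : ℕ → ℝ) (k : ℕ) (f : ℓ²) (j : ℕ) :
    jacobiBlock d a k f j =
      (if j = k then d k * f k + a k * f (k + 1) else 0) +
        (if j = k + 1 then a k * f k else 0) := by
  simp only [jacobiBlock, add_apply, smul_apply,
    rankOne_apply, inner_stdVec_left, lp.coeFn_add, lp.coeFn_smul, Pi.add_apply, Pi.smul_apply,
    smul_eq_mul, stdVec_apply]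
  split_ifs <;> ring

section Jacobi

variable {d a : ℕ → ℝ}

lemma summable_jacobiBlock (hd : Summable d) (ha : Summable a) : Summable (jacobiBlock d a) :=
  .of_norm_bounded (hd.abs.add (ha.abs.mul_right 2)) (norm_jacobiBlock_le d a)

lemma isSelfAdjoint_jacobi : IsSelfAdjoint (jacobi d a) := by
  rw [IsSelfAdjoint, jacobi, tsum_star]
  exact tsum_congr fun k => isSelfAdjoint_jacobiBlock d a k

lemma isCompactOperator_jacobi (hd : Summable d) (ha : Summable a) :
    IsCompactOperator (jacobi d a) := by
  refine isCompactOperator_of_tendsto (summable_jacobiBlock hd ha).hasSum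
    (Eventually.of_forall fun s => ?_)
  classical
  induction s using Finset.induction_on with
  | empty => simpa using isCompactOperator_zero
  | insert k s hk ih =>
    rw [Finset.sum_insert hk]
    exact (isCompactOperator_jacobiBlock d a k).add ih

lemma jacobi_apply (hd : Summable d) (ha : Summable a) (f : ℓ²) (j : ℕ) :
    jacobi d a f j = ∑' k, jacobiBlock d a k f j := by
  have h := (((summable_jacobiBlock hd ha).hasSum.mapL
    (ContinuousLinearMap.apply ℂ ℓ² f)).mapL (innerSL ℂ (stdVec j))).tsum_eq
  simpa [inner_stdVec_left, jacobi] using h.symm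

lemma jacobi_apply_zero (hd : Summable d) (ha : Summable a) (f : ℓ²) :
    jacobi d a f 0 = d 0 * f 0 + a 0 * f 1 := by
  rw [jacobi_apply hd ha, tsum_eq_single 0]
  · simp [jacobiBlock_apply]
  · intro k hk
    simp [jacobiBlock_apply, hk.symm]

lemma jacobi_apply_succ (hd : Summable d) (ha : Summable a) (f : ℓ²) (j : ℕ) :
    jacobi d a f (j + 1) = d (j + 1) * f (j + 1) + a (j + 1) * f (j + 2) + a j * f j := by
  rw [jacobi_apply hd ha, tsum_eq_sum (s := {j, j + 1})]
  · rw [Finset.sum_pair (by omega)]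
    simp [jacobiBlock_apply]
    ring
  · intro k hk
    simp only [Finset.mem_insert, Finset.mem_singleton, not_or] at hk
    rw [jacobiBlock_apply, if_neg (by omega), if_neg (by omega), add_zero]

lemma norm_sq_jacobi_stdVec_zero (hd : Summable d) (ha : Summable a) :
    ‖jacobi d a (stdVec 0)‖ ^ 2 = d 0 ^ 2 + a 0 ^ 2 := by
  rw [norm_sq_eq_tsum, tsum_eq_sum (s := Finset.range 2)]
  · simp [Finset.sum_range_succ, jacobi_apply_zero hd ha, jacobi_apply_succ hd ha, stdVec_apply]
  · intro j hj
    obtain ⟨j, rfl⟩ : ∃ k, j = k + 2 := ⟨j - 2, by simp at hj; omega⟩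
    simp [jacobi_apply_succ hd ha, stdVec_apply]

lemma norm_sq_jacobi_stdVec_succ (hd : Summable d) (ha : Summable a) (i : ℕ) :
    ‖jacobi d a (stdVec (i + 1))‖ ^ 2 = d (i + 1) ^ 2 + a (i + 1) ^ 2 + a i ^ 2 := by
  have h : ∀ j, jacobi d a (stdVec (i + 1)) j =
      (if j = i then (a i : ℂ) else 0) + (if j = i + 1 then (d (i + 1) : ℂ) else 0) +
        (if j = i + 2 then (a (i + 1) : ℂ) else 0) := by
    rintro (_ | j)
    · rw [jacobi_apply_zero hd ha]
      simp [stdVec_apply]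
      split_ifs <;> simp_all
    · rw [jacobi_apply_succ hd ha]
      simp only [stdVec_apply]
      split_ifs <;> first | omega | skip
      all_goals simp_all
  rw [norm_sq_eq_tsum, tsum_eq_sum (s := {i, i + 1, i + 2})]
  · rw [Finset.sum_insert (by simp), Finset.sum_pair (by omega)]
    simp [h]
    ring
  · intro j hj
    simp only [Finset.mem_insert, Finset.mem_singleton, not_or] at hj
    simp [h, hj]

end Jacobi

/-- For a self-adjoint Hilbert–Schmidt operator, the squares of finitely many eigenvalues sum to at
most the squared Hilbert–Schmidt norm. -/
lemma sum_norm_sq_eigenvalue_le {T : ℓ² →L[ℂ] ℓ²} (hT : IsSelfAdjoint T)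
    (hs : Summable fun k => ‖T (stdVec k)‖ ^ 2) (s : Finset ℂ)
    (hev : ∀ μ ∈ s, Module.End.HasEigenvalue (T : ℓ² →ₗ[ℂ] ℓ²) μ) :
    ∑ μ ∈ s, ‖μ‖ ^ 2 ≤ ∑' k, ‖T (stdVec k)‖ ^ 2 := by
  have hsym : (T : ℓ² →ₗ[ℂ] ℓ²).IsSymmetric := hT.isSymmetric
  have hex : ∀ μ : s, ∃ v : ℓ², ‖v‖ = 1 ∧ T v = (μ : ℂ) • v := fun μ => by
    obtain ⟨v, hv⟩ := (hev μ μ.2).exists_hasEigenvector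
    have h1 : T v = (μ : ℂ) • v := hv.apply_eq_smul
    refine ⟨((‖v‖ : ℂ)⁻¹) • v, ?_, ?_⟩
    · rw [norm_smul, norm_inv, Complex.norm_real, norm_norm,
        inv_mul_cancel₀ (norm_ne_zero_iff.mpr hv.2)]
    · rw [map_smul, h1, smul_comm]
  choose e he1 heT using hex
  have hon : Orthonormal ℂ e := by
    refine ⟨he1, fun μ ν hne => ?_⟩
    exact hsym.orthogonalFamily_eigenspaces (Subtype.coe_injective.ne hne)
      ⟨e μ, Module.End.mem_eigenspace_iff.mpr (heT μ)⟩
      ⟨e ν, Module.End.mem_eigenspace_iff.mpr (heT ν)⟩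
  have hterm : ∀ μ : s, ∀ k, ‖T (e μ) k‖ ^ 2 = ‖inner ℂ (e μ) (T (stdVec k))‖ ^ 2 := fun μ k => by
    have : inner ℂ (T (e μ)) (stdVec k) = inner ℂ (e μ) (T (stdVec k)) := hsym _ _
    rw [← this, ← inner_stdVec_left, norm_inner_symm]
  have hsum : ∀ μ : s, HasSum (fun k => ‖T (e μ) k‖ ^ 2) (‖(μ : ℂ)‖ ^ 2) := fun μ => by
    have h := lp.hasSum_norm (p := 2) (by norm_num) (T (e μ))
    have h2 : ‖T (e μ)‖ = ‖(μ : ℂ)‖ := by rw [heT, norm_smul, he1, mul_one]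
    simpa [h2] using h
  rw [← Finset.sum_coe_sort]
  refine hasSum_le (fun k => ?_) (hasSum_sum fun μ _ => hsum μ) hs.hasSum
  simp only [hterm]
  exact hon.sum_inner_products_le _

/-- If `T` is triangular with respect to a linearly independent sequence, then its diagonal entries
are eigenvalues. -/
lemma hasEigenvalue_of_triangular {K E : Type*} [Field K] [AddCommGroup E] [Module K E]
    (T : E →ₗ[K] E) (u : ℕ → E) (l : ℕ → K) (n : ℕ)
    (hu : LinearIndependent K fun i : Fin (n + 1) => u i)
    (h : ∀ k, T (u k) - l k • u k ∈ Submodule.span K (u '' Set.Iio k)) :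
    Module.End.HasEigenvalue T (l n) := by
  classical
  by_contra hne
  have hker : LinearMap.ker (T - l n • 1) = ⊥ := by
    rw [← Module.End.eigenspace_def]
    by_contra h0
    exact hne (Module.End.hasEigenvalue_iff.mpr h0)
  set W := Submodule.span K ((Finset.range n).image u : Set E) with hW
  have hmono : ∀ k ≤ n, Submodule.span K (u '' Set.Iio k) ≤ W := fun k hk => by
    refine Submodule.span_mono ?_
    rintro _ ⟨m, hm, rfl⟩
    simp only [Finset.coe_image, Finset.coe_range]
    exact ⟨m, lt_of_lt_of_le hm hk, rfl⟩
  have hmem : ∀ i : Fin (n + 1), (T - l n • 1) (u i) ∈ W := fun i => by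
    have hsplit : (T - l n • 1) (u i) =
        (T (u i) - l i • u i) + (l i - l n) • u i := by
      simp [sub_smul]
    rw [hsplit]
    refine W.add_mem (hmono i (by omega) (h i)) ?_
    rcases Nat.lt_succ_iff_lt_or_eq.mp i.2 with hi | hi
    · exact W.smul_mem _ (Submodule.subset_span (by simpa using ⟨(i : ℕ), hi, rfl⟩))
    · simp [hi]
  have hli := hu.map' _ hker
  have hliW : LinearIndependent K
      fun i : Fin (n + 1) => (⟨_, hmem i⟩ : W) := LinearIndependent.of_comp W.subtype hli
  have h1 := hliW.fintype_card_le_finrank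
  have h2 : Module.finrank K W ≤ _ :=
    finrank_span_finset_le_card (R := K) ((Finset.range n).image u)
  have h3 : ((Finset.range n).image u).card ≤ n := by
    simpa using Finset.card_image_le (s := Finset.range n) (f := u)
  rw [Fintype.card_fin] at h1
  omega

/-- The diagonal of the symmetrized matrix `P_Her`, in terms of `x = q⁻¹`. -/
def herDiag (x : ℝ) (i : ℕ) : ℝ := x ^ (2 * i) * (1 - x)

/-- The off-diagonal of the symmetrized matrix `P_Her`, in terms of `x = q⁻¹`. -/
def herOff (x : ℝ) (i : ℕ) : ℝ := √(x ^ (2 * i + 1) * (1 - x ^ (2 * i + 2)))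

/-- `√(π_Her(i) / π_Her(0))`, in terms of `x = q⁻¹`. -/
def herWeight (x : ℝ) : ℕ → ℝ
  | 0 => 1
  | i + 1 => herWeight x i * (x ^ (2 * i + 1) / herOff x i)

section Hermitian

variable {x : ℝ}

lemma herOff_arg_pos (hx : 0 < x) (hx1 : x < 1) (i : ℕ) :
    0 < x ^ (2 * i + 1) * (1 - x ^ (2 * i + 2)) :=
  mul_pos (by positivity) (sub_pos.mpr (pow_lt_one₀ hx.le hx1 (by omega)))

lemma herOff_pos (hx : 0 < x) (hx1 : x < 1) (i : ℕ) : 0 < herOff x i :=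
  Real.sqrt_pos.mpr (herOff_arg_pos hx hx1 i)

lemma herOff_sq (hx : 0 < x) (hx1 : x < 1) (i : ℕ) :
    herOff x i ^ 2 = x ^ (2 * i + 1) * (1 - x ^ (2 * i + 2)) :=
  Real.sq_sqrt (herOff_arg_pos hx hx1 i).le

lemma summable_herDiag (hx : 0 < x) (hx1 : x < 1) : Summable (herDiag x) := by
  have h : Summable fun i : ℕ => (x ^ 2) ^ i :=
    summable_geometric_of_lt_one (by positivity) (pow_lt_one₀ hx.le hx1 (by omega))
  exact (h.mul_right (1 - x)).congr fun i => by rw [herDiag, pow_mul]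

lemma summable_herOff (hx : 0 < x) (hx1 : x < 1) : Summable (herOff x) := by
  refine Summable.of_nonneg_of_le (fun i => (herOff_pos hx hx1 i).le) (fun i => ?_)
    (summable_geometric_of_lt_one hx.le hx1)
  rw [← sq_le_sq₀ (herOff_pos hx hx1 i).le (by positivity), herOff_sq hx hx1]
  have h1 : (0 : ℝ) < x ^ (2 * i) := by positivity
  have h2 : x ^ (2 * i + 1) ≤ x ^ (2 * i) := pow_le_pow_of_le_one hx.le hx1.le (by omega)
  have h3 : (0 : ℝ) < x ^ (2 * i + 2) := by positivity
  have h4 : (0 : ℝ) < x ^ (2 * i + 1) := by positivity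
  rw [← pow_mul, mul_comm i 2]
  nlinarith

lemma herWeight_pos (hx : 0 < x) (hx1 : x < 1) (i : ℕ) : 0 < herWeight x i := by
  induction i with
  | zero => exact one_pos
  | succ i ih => exact mul_pos ih (div_pos (by positivity) (herOff_pos hx hx1 i))

lemma herWeight_succ_mul_herOff (hx : 0 < x) (hx1 : x < 1) (i : ℕ) :
    herWeight x (i + 1) * herOff x i = x ^ (2 * i + 1) * herWeight x i := by
  have := (herOff_pos hx hx1 i).ne'
  rw [herWeight]
  field_simp

lemma herWeight_mul_herOff (hx : 0 < x) (hx1 : x < 1) (i : ℕ) :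
    herWeight x i * herOff x i = (1 - x ^ (2 * i + 2)) * herWeight x (i + 1) := by
  have h0 : x ^ (2 * i + 1) ≠ 0 := by positivity
  have h := herWeight_succ_mul_herOff hx hx1 i
  have h2 := herOff_sq hx hx1 i
  apply mul_left_cancel₀ h0
  linear_combination (-herOff x i) * h + herWeight x (i + 1) * h2

lemma summable_herWeight_mul_pow_sq (hx : 0 < x) (hx1 : x < 1) {c : ℝ} (hc : c ≠ 0) :
    Summable fun i => (herWeight x i * c ^ i) ^ 2 := by
  have hne : ∀ i, herWeight x i ≠ 0 := fun i => (herWeight_pos hx hx1 i).ne'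
  refine summable_of_ratio_test_tendsto_lt_one one_pos
    (Eventually.of_forall fun i => by simp [hne, hc]) ?_
  have hratio : ∀ i : ℕ, ‖(herWeight x (i + 1) * c ^ (i + 1)) ^ 2‖ / ‖(herWeight x i * c ^ i) ^ 2‖
      = c ^ 2 * x ^ (2 * i + 1) / (1 - x ^ (2 * i + 2)) := fun i => by
    have h1 : 1 - x ^ (2 * i + 2) ≠ 0 := (sub_pos.mpr (pow_lt_one₀ hx.le hx1 (by omega))).ne'
    have hw := hne i
    have ho := (herOff_pos hx hx1 i).ne'
    rw [Real.norm_of_nonneg (sq_nonneg _), Real.norm_of_nonneg (sq_nonneg _), herWeight]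
    have h2 := herOff_sq hx hx1 i
    have h3 : (herWeight x i * (x ^ (2 * i + 1) / herOff x i) * c ^ (i + 1)) ^ 2 =
        (herWeight x i * c ^ i) ^ 2 * (c ^ 2 * (x ^ (2 * i + 1)) ^ 2 / herOff x i ^ 2) := by
      field_simp
      ring
    rw [h3, mul_div_cancel_left₀ _ (by simp [hw, hc]), h2]
    field_simp
  simp only [hratio]
  have ht : Tendsto (fun i : ℕ => x ^ i) atTop (𝓝 0) :=
    tendsto_pow_atTop_nhds_zero_of_lt_one hx.le hx1
  have t1 : Tendsto (fun i : ℕ => x ^ (2 * i + 1)) atTop (𝓝 0) :=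
    ht.comp (tendsto_atTop_mono (fun i => show i ≤ _ by omega) tendsto_id)
  have t2 : Tendsto (fun i : ℕ => x ^ (2 * i + 2)) atTop (𝓝 0) :=
    ht.comp (tendsto_atTop_mono (fun i => show i ≤ _ by omega) tendsto_id)
  have t3 : Tendsto (fun i : ℕ => c ^ 2 * x ^ (2 * i + 1) / (1 - x ^ (2 * i + 2))) atTop
      (𝓝 (c ^ 2 * 0 / (1 - 0))) := (t1.const_mul (c ^ 2)).div (t2.const_sub 1) (by norm_num)
  simpa using t3

/-- The symmetrization of `P_Her` maps the sequence `√π_Her(i) c ^ i` to a combination of the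
sequences with parameters `c` and `x ^ 2 * c`. -/
lemma jacobi_her_apply_of_pow (hx : 0 < x) (hx1 : x < 1) {c : ℝ} (hc : c ≠ 0) {u v : ℓ²}
    (hu : ∀ j, u j = ((herWeight x j * c ^ j : ℝ) : ℂ))
    (hv : ∀ j, v j = ((herWeight x j * (x ^ 2 * c) ^ j : ℝ) : ℂ)) :
    jacobi (herDiag x) (herOff x) u =
      ((c⁻¹ : ℝ) : ℂ) • u + (((c - 1) * (x * c + 1) / c : ℝ) : ℂ) • v := by
  have hd := summable_herDiag hx hx1
  have ha := summable_herOff hx hx1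
  ext (_ | j)
  · rw [jacobi_apply_zero hd ha]
    simp only [lp.coeFn_add, lp.coeFn_smul, Pi.add_apply, Pi.smul_apply, smul_eq_mul, hu, hv]
    norm_cast
    have h := herWeight_succ_mul_herOff hx hx1 0
    simp only [herWeight, herDiag, mul_zero, zero_add, pow_zero, pow_one, mul_one] at h ⊢
    field_simp
    linear_combination (c ^ 2) * h
  · rw [jacobi_apply_succ hd ha]
    simp only [lp.coeFn_add, lp.coeFn_smul, Pi.add_apply, Pi.smul_apply, smul_eq_mul, hu, hv]
    norm_cast
    have h1 := herWeight_succ_mul_herOff hx hx1 (j + 1)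
    have h2 := herWeight_mul_herOff hx hx1 j
    have h3 : herOff x (j + 1) * (herWeight x (j + 1 + 1) * c ^ (j + 2)) =
        x ^ (2 * (j + 1) + 1) * herWeight x (j + 1) * c ^ (j + 2) := by
      linear_combination c ^ (j + 2) * h1
    have h4 : herOff x j * (herWeight x j * c ^ j) =
        (1 - x ^ (2 * j + 2)) * herWeight x (j + 1) * c ^ j := by
      linear_combination c ^ j * h2
    rw [h3, h4, herDiag, mul_pow, ← pow_mul]
    field_simp
    ring

lemma exists_herWeight_mul_pow (hx : 0 < x) (hx1 : x < 1) {c : ℝ} (hc : c ≠ 0) :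
    ∃ u : ℓ², ∀ j, u j = ((herWeight x j * c ^ j : ℝ) : ℂ) := by
  refine ⟨⟨fun j => ((herWeight x j * c ^ j : ℝ) : ℂ), memℓp_gen ?_⟩, fun j => rfl⟩
  refine (summable_herWeight_mul_pow_sq hx hx1 hc).congr fun i => ?_
  rw [Complex.norm_real, ENNReal.toReal_ofNat, Real.rpow_ofNat, Real.norm_eq_abs, sq_abs]

lemma hasEigenvalue_jacobi_her (hx : 0 < x) (hx1 : x < 1) (n : ℕ) :
    Module.End.HasEigenvalue (jacobi (herDiag x) (herOff x) : ℓ² →ₗ[ℂ] ℓ²) ((-(x : ℂ)) ^ n) := by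
  set y : ℝ := -x⁻¹ with hy
  have hx0 := hx.ne'
  have hy0 : y ≠ 0 := by simp [hy, hx0]
  have hxy : x * y = -1 := by simp [hy, hx0]
  have hx2 : x ^ 2 * y ^ 2 = 1 := by rw [← mul_pow, hxy]; norm_num
  choose u hu using fun k : ℕ => exists_herWeight_mul_pow hx hx1 (pow_ne_zero k hy0)
  refine hasEigenvalue_of_triangular _ u (fun k => (-(x : ℂ)) ^ k) n ?_ fun k => ?_
  · rw [Fintype.linearIndependent_iff]
    intro g hg
    refine congr_fun (Matrix.eq_zero_of_forall_index_sum_pow_mul_eq_zero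
      (f := fun j : Fin (n + 1) => (y : ℂ) ^ (j : ℕ)) ?_ fun j => ?_)
    · intro i j hij
      have h1 : |y| ^ (i : ℕ) = |y| ^ (j : ℕ) := by
        simpa using congr_arg norm hij
      have h2 : 1 < |y| := by
        rw [hy, abs_neg, abs_of_pos (by positivity)]
        exact (one_lt_inv₀ hx).mpr hx1
      exact Fin.ext (pow_right_injective₀ (by positivity) h2.ne' h1)
    · have h := congr_arg (inner ℂ (stdVec j)) hg
      simp only [inner_sum, inner_smul_right, inner_stdVec_left, hu, inner_zero_right] at h
      have hw : (herWeight x j : ℂ) ≠ 0 := by exact_mod_cast (herWeight_pos hx hx1 j).ne'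
      apply (mul_eq_zero.mp _).resolve_left hw
      rw [Finset.mul_sum, ← h]
      refine Finset.sum_congr rfl fun i _ => ?_
      push_cast
      rw [← pow_mul, ← pow_mul, mul_comm (i : ℕ)]
      ring
  · have hinv : (((y ^ k)⁻¹ : ℝ) : ℂ) = (-(x : ℂ)) ^ k := by
      rw [← inv_pow, hy, ← neg_inv, inv_inv]
      push_cast
      rfl
    obtain ⟨v, hv⟩ := exists_herWeight_mul_pow hx hx1
      (c := x ^ 2 * y ^ k) (mul_ne_zero (by positivity) (pow_ne_zero k hy0))
    have h := jacobi_her_apply_of_pow hx hx1 (pow_ne_zero k hy0) (hu k) hv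
    rw [hinv] at h
    rw [ContinuousLinearMap.coe_coe, h, add_sub_cancel_left]
    match k with
    | 0 => simp
    | 1 => simp [hxy]
    | k + 2 =>
      have hvu : v = u k := by
        ext j
        rw [hv, hu, pow_add, mul_left_comm, hx2, mul_one]
      rw [hvu]
      exact Submodule.smul_mem _ _ (Submodule.subset_span ⟨k, by simp, rfl⟩)

lemma hasSum_norm_sq_jacobi_her (hx : 0 < x) (hx1 : x < 1) :
    HasSum (fun i => ‖jacobi (herDiag x) (herOff x) (stdVec i)‖ ^ 2) (1 - x ^ 2)⁻¹ := by
  have hd := summable_herDiag hx hx1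
  have ha := summable_herOff hx hx1
  have h2 : x ^ 2 < 1 := pow_lt_one₀ hx.le hx1 (by omega)
  have h4 : x ^ 4 < 1 := pow_lt_one₀ hx.le hx1 (by omega)
  have s2 := (hasSum_geometric_of_lt_one (by positivity) h2).mul_left (x + x⁻¹)
  have s4 := (hasSum_geometric_of_lt_one (by positivity) h4).mul_left ((1 - x) ^ 2 - x ^ 3 - x⁻¹)
  have hval : ((1 - x) ^ 2 - x ^ 3 - x⁻¹) * (1 - x ^ 4)⁻¹ + (x + x⁻¹) * (1 - x ^ 2)⁻¹ =
      (1 - x ^ 2)⁻¹ := by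
    have e2 : 1 - x ^ 2 ≠ 0 := by linarith
    have e4 : 1 - x ^ 4 ≠ 0 := by linarith
    field_simp
    ring
  refine hval ▸ (s4.add s2).congr_fun ?_
  rintro (_ | i)
  · rw [norm_sq_jacobi_stdVec_zero hd ha, herOff_sq hx hx1, herDiag]
    simp
    ring
  · rw [norm_sq_jacobi_stdVec_succ hd ha, herOff_sq hx hx1, herOff_sq hx hx1, herDiag]
    field_simp
    ring

lemma herDiag_add_herOff_lt (hx : 0 < x) (hx3 : x ≤ 1 / 3) (i : ℕ) :
    herDiag x (i + 1) + herOff x (i + 1) < herOff x i := by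
  have hx1 : x < 1 := by linarith
  have p := herOff_pos hx hx1
  have hsq0 := herOff_sq hx hx1 i
  have hsq1 := herOff_sq hx hx1 (i + 1)
  have hP : 0 < x ^ (2 * i + 1) := by positivity
  have hx9 : x ^ 2 ≤ 1 / 9 := by nlinarith
  have hQ : x ^ (2 * i + 2) ≤ 1 / 9 := (pow_le_pow_of_le_one hx.le hx1.le (by omega)).trans hx9
  have hQ0 : 0 < x ^ (2 * i + 2) := by positivity
  have h1 : herOff x (i + 1) ≤ herOff x i / 2 := by
    rw [← sq_le_sq₀ (p _).le (by linarith [p i]), div_pow, hsq0, hsq1]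
    have e : x ^ (2 * (i + 1) + 1) = x ^ (2 * i + 1) * x ^ 2 := by ring
    have f : 0 < x ^ (2 * (i + 1) + 2) := by positivity
    rw [e]
    nlinarith [mul_pos hP f, mul_pos (mul_pos hP f) (pow_pos hx 2)]
  have h2 : herDiag x (i + 1) < herOff x i / 2 := by
    have hd0 : herDiag x (i + 1) ≤ x ^ (2 * i + 2) := by
      rw [herDiag, show 2 * (i + 1) = 2 * i + 2 by ring]
      nlinarith
    refine hd0.trans_lt ?_
    rw [← sq_lt_sq₀ hQ0.le (by linarith [p i]), div_pow, hsq0]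
    have e : x ^ (2 * i + 2) = x ^ (2 * i + 1) * x := by ring
    have g : (x ^ (2 * i + 2)) ^ 2 = x ^ (2 * i + 1) * (x * x ^ (2 * i + 2)) := by ring
    rw [g]
    nlinarith [mul_pos hx hQ0]
  linarith

lemma eq_zero_of_jacobi_her_eq_zero (hx : 0 < x) (hx3 : x ≤ 1 / 3) {v : ℓ²}
    (hv : jacobi (herDiag x) (herOff x) v = 0) : v = 0 := by
  have hx1 : x < 1 := by linarith
  by_contra hne
  obtain ⟨m, hm⟩ : ∃ m, v m ≠ 0 := by
    by_contra! h
    exact hne (lp.ext (funext h))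
  have hmpos : 0 < ‖v m‖ := norm_pos_iff.mpr hm
  have htend : Tendsto (fun j => ‖v j‖) cofinite (𝓝 0) := by
    have h := ((lp.memℓp v).summable (by norm_num)).tendsto_cofinite_zero
    have h' := h.sqrt
    simpa using h'
  obtain ⟨n, hn⟩ : ∃ n, ∀ j, ‖v j‖ ≤ ‖v n‖ := by
    refine (continuous_of_discreteTopology (f := fun j : ℕ => ‖v j‖)).exists_forall_ge' m ?_
    rw [cocompact_eq_cofinite]
    exact htend.eventually_le_const hmpos
  have hnpos : 0 < ‖v n‖ := hmpos.trans_le (hn m)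
  have h := jacobi_apply_succ (summable_herDiag hx hx1) (summable_herOff hx hx1) v n
  rw [hv] at h
  have hd : 0 ≤ herDiag x (n + 1) := mul_nonneg (by positivity) (by linarith)
  have ha := fun i => (herOff_pos hx hx1 i).le
  have heq : (herOff x n : ℂ) * v n =
      -(herDiag x (n + 1) * v (n + 1) + herOff x (n + 1) * v (n + 2)) := by
    simp only [lp.coeFn_zero, Pi.zero_apply] at h
    linear_combination -h
  have hle : herOff x n * ‖v n‖ ≤ herDiag x (n + 1) * ‖v n‖ + herOff x (n + 1) * ‖v n‖ := by
    calc herOff x n * ‖v n‖ = ‖(herOff x n : ℂ) * v n‖ := by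
          rw [norm_mul, Complex.norm_real, Real.norm_of_nonneg (ha n)]
      _ ≤ ‖(herDiag x (n + 1) : ℂ) * v (n + 1)‖ + ‖(herOff x (n + 1) : ℂ) * v (n + 2)‖ := by
          rw [heq, norm_neg]
          exact norm_add_le _ _
      _ = herDiag x (n + 1) * ‖v (n + 1)‖ + herOff x (n + 1) * ‖v (n + 2)‖ := by
          rw [norm_mul, norm_mul, Complex.norm_real, Complex.norm_real, Real.norm_of_nonneg hd,
            Real.norm_of_nonneg (ha _)]
      _ ≤ _ := by gcongr <;> first | exact hn _ | exact ha _
  nlinarith [herDiag_add_herOff_lt hx hx3 n]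

lemma hasEigenvalue_jacobi_her_iff (hx : 0 < x) (hx3 : x ≤ 1 / 3) (μ : ℂ) :
    Module.End.HasEigenvalue (jacobi (herDiag x) (herOff x) : ℓ² →ₗ[ℂ] ℓ²) μ ↔
      ∃ k : ℕ, μ = (-(x : ℂ)) ^ k := by
  have hx1 : x < 1 := by linarith
  refine ⟨fun hμ => ?_, fun ⟨k, hk⟩ => hk ▸ hasEigenvalue_jacobi_her hx hx1 k⟩
  by_contra! hne
  have hinj : Function.Injective fun k : ℕ => (-(x : ℂ)) ^ k := fun i j hij => by
    have h1 : |x| ^ i = |x| ^ j := by simpa using congr_arg norm hij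
    rw [abs_of_pos hx] at h1
    exact pow_right_injective₀ hx hx1.ne h1
  have hS := hasSum_norm_sq_jacobi_her hx hx1
  have hbound : ∀ N : ℕ, ∑ k ∈ Finset.range N, (x ^ 2) ^ k + ‖μ‖ ^ 2 ≤ (1 - x ^ 2)⁻¹ := fun N => by
    classical
    have h := sum_norm_sq_eigenvalue_le isSelfAdjoint_jacobi hS.summable
      (insert μ ((Finset.range N).image fun k : ℕ => (-(x : ℂ)) ^ k)) (by
        intro ν hν
        rcases Finset.mem_insert.mp hν with rfl | hν
        · exact hμ
        · obtain ⟨k, -, rfl⟩ := Finset.mem_image.mp hν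
          exact hasEigenvalue_jacobi_her hx hx1 k)
    rw [hS.tsum_eq, Finset.sum_insert (by
      simp only [Finset.mem_image, not_exists, not_and]
      exact fun k _ hk => hne k hk.symm), Finset.sum_image hinj.injOn] at h
    refine le_trans (le_of_eq ?_) h
    rw [add_comm]
    congr 1
    refine Finset.sum_congr rfl fun k _ => ?_
    rw [norm_pow, norm_neg, Complex.norm_real, Real.norm_of_nonneg hx.le, ← pow_mul, ← pow_mul,
      mul_comm]
  have hlim := (hasSum_geometric_of_lt_one (sq_nonneg x)
    (pow_lt_one₀ hx.le hx1 two_ne_zero)).tendsto_sum_nat.add_const (‖μ‖ ^ 2)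
  have hle := le_of_tendsto' hlim hbound
  have hμ0 : μ = 0 := by
    rw [← norm_eq_zero, ← sq_eq_zero_iff]
    exact le_antisymm (by linarith) (sq_nonneg _)
  obtain ⟨v, hv⟩ := hμ.exists_hasEigenvector
  refine hv.2 (eq_zero_of_jacobi_her_eq_zero hx hx3 ?_)
  have := hv.apply_eq_smul
  rwa [hμ0, zero_smul] at this

end Hermitian

section SymmetrizedMatrix

variable {q : ℝ}

lemma betaQ_pos (hq : 1 < q) : 0 < betaQ q := by
  have hx : 0 < q⁻¹ := by positivity
  have hx1 : q⁻¹ < 1 := inv_lt_one_of_one_lt₀ hq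
  have hs : Summable fun i : ℕ => q⁻¹ ^ (2 * i + 1) :=
    (summable_geometric_of_lt_one hx.le hx1).comp_injective
      (i := fun i : ℕ => 2 * i + 1) fun a b h => by simpa using h
  rw [betaQ, ← Real.rexp_tsum_eq_tprod (fun i => by positivity)]
  · exact Real.exp_pos _
  · simpa only [Real.log_inv] using (Real.summable_log_one_add_of_summable hs).neg

lemma piHer_pos (hq : 1 < q) (j : ℕ) : 0 < piHer q j := by
  refine div_pos (betaQ_pos hq) (mul_pos (by positivity) (Finset.prod_pos fun i _ => ?_))
  exact sub_pos.mpr (pow_lt_one₀ (by positivity) (inv_lt_one_of_one_lt₀ hq) (by omega))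

lemma piHer_succ (j : ℕ) :
    piHer q (j + 1) = piHer q j * (q⁻¹ ^ (2 * j + 1) / (1 - q⁻¹ ^ (2 * j + 2))) := by
  rw [piHer, piHer, Finset.prod_range_succ, show (j + 1) ^ 2 = j ^ 2 + (2 * j + 1) by ring, pow_add,
    inv_pow q (2 * j + 1), show 2 * (j + 1) = 2 * j + 2 by ring, div_mul_div_comm, ← div_eq_mul_inv,
    div_div]
  congr 1
  ring

lemma PHer_mul_sqrt_self (hq : 1 < q) (j : ℕ) :
    PHer q j j * √(piHer q j / piHer q j) = herDiag q⁻¹ j := by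
  rw [div_self (piHer_pos hq j).ne']
  simp [PHer, herDiag]

lemma PHer_mul_sqrt_succ (hq : 1 < q) (j : ℕ) :
    PHer q (j + 1) j * √(piHer q (j + 1) / piHer q j) = herOff q⁻¹ j := by
  have h1 : 0 < 1 - q⁻¹ ^ (2 * j + 2) :=
    sub_pos.mpr (pow_lt_one₀ (by positivity) (inv_lt_one_of_one_lt₀ hq) (by omega))
  have hP : PHer q (j + 1) j = 1 - q⁻¹ ^ (2 * j + 2) := by
    rw [PHer, if_neg (by omega), if_neg (by omega), if_pos rfl, mul_add, mul_one]
  rw [piHer_succ, mul_div_cancel_left₀ _ (piHer_pos hq j).ne', hP, herOff]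
  nth_rewrite 1 [← Real.sqrt_sq h1.le]
  rw [← Real.sqrt_mul (sq_nonneg _)]
  congr 1
  field_simp

lemma PHer_succ_mul_sqrt (hq : 1 < q) (j : ℕ) :
    PHer q j (j + 1) * √(piHer q j / piHer q (j + 1)) = herOff q⁻¹ j := by
  have h1 : 0 < 1 - q⁻¹ ^ (2 * j + 2) :=
    sub_pos.mpr (pow_lt_one₀ (by positivity) (inv_lt_one_of_one_lt₀ hq) (by omega))
  have h2 : 0 < q⁻¹ ^ (2 * j + 1) := by positivity
  have hP : PHer q j (j + 1) = q⁻¹ ^ (2 * j + 1) := by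
    rw [PHer, if_pos rfl]
  rw [piHer_succ, div_mul_cancel_left₀ (piHer_pos hq j).ne', hP, herOff, inv_div]
  generalize q⁻¹ ^ (2 * j + 1) = a at h2 ⊢
  nth_rewrite 1 [← Real.sqrt_sq h2.le]
  rw [← Real.sqrt_mul (sq_nonneg _)]
  congr 1
  field_simp

lemma PHer_eq_zero (i j : ℕ) (h : j + 1 < i ∨ i + 1 < j) : PHer q i j = 0 := by
  rw [PHer, if_neg (by omega), if_neg (by omega), if_neg (by omega)]

lemma jacobi_her_apply_eq_tsum (hq : 1 < q) (f : ℓ²) (j : ℕ) :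
    jacobi (herDiag q⁻¹) (herOff q⁻¹) f j =
      ∑' i : ℕ, f i * ((PHer q i j * √(piHer q i / piHer q j) : ℝ) : ℂ) := by
  have hx : 0 < q⁻¹ := by positivity
  have hx1 : q⁻¹ < 1 := inv_lt_one_of_one_lt₀ hq
  rw [tsum_eq_sum (s := Finset.range (j + 2)) fun i hi => by
    rw [PHer_eq_zero i j (Or.inl (by simp at hi; omega))]; simp]
  rcases j with _ | j
  · rw [jacobi_apply_zero (summable_herDiag hx hx1) (summable_herOff hx hx1), zero_add,
      Finset.sum_range_succ, Finset.sum_range_one, PHer_mul_sqrt_self hq,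
      PHer_mul_sqrt_succ hq]
    ring
  · rw [jacobi_apply_succ (summable_herDiag hx hx1) (summable_herOff hx hx1),
      Finset.sum_range_succ, Finset.sum_range_succ, Finset.sum_range_succ, PHer_mul_sqrt_self hq,
      PHer_mul_sqrt_succ hq, PHer_succ_mul_sqrt hq, Finset.sum_eq_zero fun i hi => by
        rw [PHer_eq_zero i (j + 1) (Or.inr (by simp at hi; omega))]; simp]
    ring

end SymmetrizedMatrix

end Spectrum

/-- For every odd prime power `q`, the operator `μ ↦ μP_Her` on `ℓ²(π_Her)`
(realized on standard `ℓ²(ℕ,ℂ)` via `μ ↦ (μ(i)/√π_Her(i))`) is Hilbert–Schmidt (in particular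
compact) and self-adjoint, with eigenvalue set exactly `{(−q)^{−k} : k ≥ 0}`. -/
theorem stmt16 (q : ℕ) (hq : IsPrimePow q) (hodd : Odd q) :
    ∃ T : lp (fun _ : ℕ => ℂ) 2 →L[ℂ] lp (fun _ : ℕ => ℂ) 2,
      (∀ (f : lp (fun _ : ℕ => ℂ) 2) (j : ℕ),
        T f j = ∑' i : ℕ,
          f i * ((PHer q i j * Real.sqrt (piHer q i / piHer q j) : ℝ) : ℂ)) ∧
      Summable (fun k : ℕ => ‖T (lp.single 2 k 1)‖ ^ 2) ∧
      IsCompactOperator T ∧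
      IsSelfAdjoint T ∧
      (∀ μ : ℂ,
        Module.End.HasEigenvalue
            (T : lp (fun _ : ℕ => ℂ) 2 →ₗ[ℂ] lp (fun _ : ℕ => ℂ) 2) μ
          ↔ ∃ k : ℕ, μ = (-(q : ℂ))⁻¹ ^ k) := by
  have hq3 : (3 : ℝ) ≤ q := by
    have h1 := hq.one_lt
    obtain ⟨m, rfl⟩ := hodd
    exact_mod_cast show 3 ≤ 2 * m + 1 by omega
  have hx : 0 < (q : ℝ)⁻¹ := by positivity
  have hx3 : (q : ℝ)⁻¹ ≤ 1 / 3 := by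
    rw [one_div]
    exact inv_anti₀ (by norm_num) hq3
  have hx1 : (q : ℝ)⁻¹ < 1 := by linarith
  refine ⟨jacobi (herDiag (q : ℝ)⁻¹) (herOff (q : ℝ)⁻¹),
    jacobi_her_apply_eq_tsum (by linarith), (hasSum_norm_sq_jacobi_her hx hx1).summable,
    isCompactOperator_jacobi (summable_herDiag hx hx1) (summable_herOff hx hx1),
    isSelfAdjoint_jacobi, fun μ => ?_⟩
  rw [hasEigenvalue_jacobi_her_iff hx hx3]
  simp [inv_neg]
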